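/- For D > 2 and every t ≥ 0 such that (D−2) x̄ γ̃(t) < 2 D γ₂² α^D, the gradient-flow trajectory satisfies ‖w(t)‖_∞ ≤ α^D h_D( ((D−2) x̄ / (2 D γ₂² α^D)) · γ̃(t) ). -/

import Mathlib

open Real Finset Filter Topology MeasureTheory

/-- A solution of the linear equation `u' = a u` with continuous coefficient stays positive. -/
lemma pos_of_hasDerivAt_mul {u a : ℝ → ℝ} (ha : ContinuousOn a (Set.Ici 0))
    (hu : ∀ t, 0 ≤ t → HasDerivAt u (a t * u t) t) (h0 : 0 < u 0) {t : ℝ} (ht : 0 ≤ t) :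
    0 < u t := by
  have hb : Continuous fun s => a (max 0 s) :=
    ha.comp_continuous (by fun_prop) fun s => le_max_left 0 s
  set A : ℝ → ℝ := fun t => ∫ s in (0 : ℝ)..t, a (max 0 s) with hA
  have hA' : ∀ s, 0 ≤ s → HasDerivAt A (a s) s := fun s hs => by
    have := hb.integral_hasStrictDerivAt 0 s
    simpa [max_eq_right hs] using this.hasDerivAt
  have hg : ∀ s, 0 ≤ s → HasDerivAt (fun s => u s * Real.exp (-A s)) 0 s := fun s hs => by
    refine ((hu s hs).fun_mul (hA' s hs).fun_neg.exp).congr_deriv ?_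
    ring
  have hc : u t * Real.exp (-A t) = u 0 * Real.exp (-A 0) := by
    refine constant_of_has_deriv_right_zero (f := fun s => u s * Real.exp (-A s)) (a := 0) (b := t)
      (fun s hs => (hg s hs.1).continuousAt.continuousWithinAt)
      (fun s hs => (hg s hs.1).hasDerivWithinAt) t ⟨ht, le_rfl⟩
  have : 0 < u t * Real.exp (-A t) := by rw [hc]; positivity
  exact pos_of_mul_pos_left this (Real.exp_pos _).le

/-- Along `u' = u ^ (k + 1) c`, the power `u ^ (-k)` has derivative `-k c`. -/
lemma hasDerivAt_inv_pow {u : ℝ → ℝ} {c t : ℝ} {k : ℕ} (hpos : 0 < u t)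
    (hu : HasDerivAt u (c * u t ^ (k + 1)) t) :
    HasDerivAt (fun s => (u s ^ k)⁻¹) (-(k * c)) t := by
  rcases k with _ | k
  · simpa using hasDerivAt_const t (1 : ℝ)
  · refine ((hu.fun_pow (k + 1)).fun_inv (pow_pos hpos (k + 1)).ne').congr_deriv ?_
    simp only [Nat.add_sub_cancel]
    field_simp
    ring

lemma two_mul_pow_le_of_inv_pow_add_inv_pow {a u v : ℝ} {k : ℕ} (hk : k ≠ 0) (ha : 0 < a)
    (hu : 0 < u) (hv : 0 < v) (h : (u ^ k)⁻¹ + (v ^ k)⁻¹ = 2 * (a ^ k)⁻¹) (m : ℕ) :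
    2 * a ^ (2 * m) ≤ u ^ (2 * m) + v ^ (2 * m) := by
  have h1 : (u ^ k)⁻¹ * (v ^ k)⁻¹ ≤ (a ^ k)⁻¹ ^ 2 := by
    have ha' : (a ^ k)⁻¹ = ((u ^ k)⁻¹ + (v ^ k)⁻¹) / 2 := by linarith
    rw [ha']
    linarith [sq_nonneg ((u ^ k)⁻¹ - (v ^ k)⁻¹)]
  have h2 : (a ^ 2) ^ k ≤ (u * v) ^ k := by
    rw [← mul_inv, inv_pow, inv_le_inv₀ (by positivity) (by positivity)] at h1
    calc (a ^ 2) ^ k = (a ^ k) ^ 2 := by ring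
      _ ≤ u ^ k * v ^ k := h1
      _ = (u * v) ^ k := by ring
  have h3 : a ^ 2 ≤ u * v := le_of_pow_le_pow_left₀ hk (by positivity) h2
  have h4 : (a ^ 2) ^ m ≤ (u * v) ^ m := by gcongr
  rw [mul_pow] at h4
  rw [pow_mul, pow_mul' u, pow_mul' v]
  nlinarith [sq_nonneg (u ^ m - v ^ m)]

/-- Nonnegative combinations of points with margin at least `g` have norm at least `g ‖e‖₁`. -/
lemma margin_sq_mul_le {ι κ : Type*} [Fintype ι] [Fintype κ] {x : ι → κ → ℝ} {v : κ → ℝ} {g : ℝ}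
    (hg : 0 ≤ g) (hv : ∑ i, v i ^ 2 = 1) (hm : ∀ n, g ≤ ∑ i, x n i * v i)
    {e : ι → ℝ} (he : ∀ n, 0 ≤ e n) :
    g ^ 2 * (∑ n, e n) ^ 2 ≤ ∑ i, (∑ n, e n * x n i) ^ 2 := by
  have h1 : g * ∑ n, e n ≤ ∑ i, (∑ n, e n * x n i) * v i := by
    calc g * ∑ n, e n = ∑ n, e n * g := by rw [mul_comm, sum_mul]
      _ ≤ ∑ n, e n * ∑ i, x n i * v i :=
        sum_le_sum fun n _ => mul_le_mul_of_nonneg_left (hm n) (he n)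
      _ = ∑ i, (∑ n, e n * x n i) * v i := by
        simp only [mul_sum, sum_mul]
        rw [sum_comm]
        simp only [mul_assoc]
  have h2 := sum_mul_sq_le_sq_mul_sq univ (fun i => ∑ n, e n * x n i) v
  rw [hv, mul_one] at h2
  have h3 : 0 ≤ ∑ n, e n := sum_nonneg fun n _ => he n
  calc g ^ 2 * (∑ n, e n) ^ 2 = (g * ∑ n, e n) ^ 2 := by ring
    _ ≤ _ := pow_le_pow_left₀ (by positivity) h1 2
    _ ≤ _ := h2

lemma abs_sum_mul_le {ι : Type*} [Fintype ι] {e y : ι → ℝ} (he : ∀ n, 0 ≤ e n) :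
    |∑ n, e n * y n| ≤ (∑ n, |y n|) * ∑ n, e n := by
  calc |∑ n, e n * y n| ≤ ∑ n, |e n * y n| := abs_sum_le_sum_abs _ _
    _ ≤ ∑ n, |y n| * ∑ m, e m := by
      refine sum_le_sum fun n _ => ?_
      rw [abs_mul, abs_of_nonneg (he n), mul_comm]
      exact mul_le_mul_of_nonneg_left
        (single_le_sum (fun m _ => he m) (mem_univ n)) (abs_nonneg _)
    _ = _ := by rw [sum_mul]

lemma monotoneOn_Ici_of_hasDerivAt_nonneg {f f' : ℝ → ℝ}
    (hf : ∀ t, 0 ≤ t → HasDerivAt f (f' t) t) (hf' : ∀ t, 0 ≤ t → 0 ≤ f' t) :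
    MonotoneOn f (Set.Ici 0) := by
  refine monotoneOn_of_hasDerivWithinAt_nonneg (f' := f') (convex_Ici 0)
    (fun t ht => (hf t ht).continuousAt.continuousWithinAt)
    (fun t ht => (hf t (interior_subset ht)).hasDerivWithinAt)
    (fun t ht => hf' t (interior_subset ht))

lemma pow_eq_mul_rpow_of_inv_pow {a u p : ℝ} {k D : ℕ} (hk : k ≠ 0) (ha : 0 < a) (hu : 0 < u)
    (hp : p = a ^ k * (u ^ k)⁻¹) :
    u ^ D = a ^ D * p ^ (-(D : ℝ) / (k : ℝ)) := by
  have hk' : (k : ℝ) ≠ 0 := by exact_mod_cast hk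
  have h1 : p = (a / u) ^ (k : ℝ) := by
    rw [hp, Real.rpow_natCast, div_pow, div_eq_mul_inv]
  rw [h1, ← Real.rpow_mul (by positivity), mul_div_cancel₀ _ hk', Real.rpow_neg (by positivity),
    Real.rpow_natCast, div_pow]
  field_simp

/-- Monotonicity of `z ↦ (1 - z) ^ s - (1 + z) ^ s` for nonpositive `s`, in odd form. -/
lemma abs_rpow_sub_rpow_le {b z s : ℝ} (hs : s ≤ 0) (hbz : |b| ≤ z) (hz : z < 1) :
    |(1 - b) ^ s - (1 + b) ^ s| ≤ (1 - z) ^ s - (1 + z) ^ s := by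
  obtain ⟨h1, h2⟩ := abs_le.mp hbz
  have a1 := Real.rpow_le_rpow_of_nonpos (x := 1 - z) (y := 1 - b) (by linarith) (by linarith) hs
  have a2 := Real.rpow_le_rpow_of_nonpos (x := 1 - z) (y := 1 + b) (by linarith) (by linarith) hs
  have a3 := Real.rpow_le_rpow_of_nonpos (x := 1 - b) (y := 1 + z) (by linarith) (by linarith) hs
  have a4 := Real.rpow_le_rpow_of_nonpos (x := 1 + b) (y := 1 + z) (by linarith) (by linarith) hs
  rw [abs_le]
  constructor <;> linarith

theorem stmt6
    (d N D : ℕ) (hd : 0 < d) (hN : 0 < N) (hD : 2 < D)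
    (x : Fin N → Fin d → ℝ)
    (γ₂ : ℝ) (hγ₂pos : 0 < γ₂)
    (hγ₂ : IsGreatest {g : ℝ | ∃ v : Fin d → ℝ, (∑ i, (v i)^2) = 1 ∧ ∀ n, g ≤ ∑ i, x n i * v i} γ₂)
    (α : ℝ) (hα : 0 < α)
    (up um : ℝ → Fin d → ℝ)
    (hinit : ∀ i, up 0 i = α ∧ um 0 i = α)
    (w : ℝ → Fin d → ℝ)
    (hw : ∀ t i, w t i = (up t i)^D - (um t i)^D)
    (hflowp : ∀ t, 0 ≤ t → ∀ i, HasDerivAt (fun s => up s i)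
        (((D:ℝ)/(N:ℝ)) * (up t i)^(D-1) * ∑ n, Real.exp (-(∑ j, x n j * w t j)) * x n i) t)
    (hflowm : ∀ t, 0 ≤ t → ∀ i, HasDerivAt (fun s => um s i)
        (-(((D:ℝ)/(N:ℝ)) * (um t i)^(D-1) * ∑ n, Real.exp (-(∑ j, x n j * w t j)) * x n i)) t)
    (Lf : ℝ → ℝ)
    (hLf : ∀ t, Lf t = (1 / (N:ℝ)) * ∑ n, Real.exp (-(∑ i, x n i * w t i)))
    (xbar : ℝ)
    (hxbar : IsGreatest {v : ℝ | ∃ i : Fin d, v = ∑ n, |x n i|} xbar)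
    :
    ∀ t : ℝ, 0 ≤ t →
      ((D:ℝ)-2) * xbar * (-Real.log (Lf t)) < 2 * (D:ℝ) * γ₂^2 * α^D →
      ∀ i : Fin d, ∀ z : ℝ,
      z = (((D:ℝ)-2) * xbar / (2 * (D:ℝ) * γ₂^2 * α^D)) * (-Real.log (Lf t)) →
      |w t i| ≤ α^D * ((1 - z) ^ (-(D:ℝ)/((D:ℝ)-2)) - (1 + z) ^ (-(D:ℝ)/((D:ℝ)-2))) := by
  obtain ⟨k, hk0, rfl⟩ : ∃ k, k ≠ 0 ∧ D = k + 2 := ⟨D - 2, by omega, by omega⟩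
  have hD2 : ((k + 2 : ℕ) : ℝ) - 2 = k := by push_cast; ring
  have hD1 : k + 2 - 1 = k + 1 := rfl
  rw [hD2]
  simp only [hD1] at hflowp hflowm
  set d' : ℝ := ((k + 2 : ℕ) : ℝ) with hd'
  have hd'pos : 0 < d' := by positivity
  have hkpos : (0 : ℝ) < k := by positivity
  have hNpos : (0 : ℝ) < N := by exact_mod_cast hN
  obtain ⟨v, hv1, hvm⟩ := hγ₂.1
  set e : ℝ → Fin N → ℝ := fun t n => Real.exp (-(∑ j, x n j * w t j)) with he
  have he0 : ∀ t n, 0 ≤ e t n := fun t n => (Real.exp_pos _).le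
  set S : ℝ → Fin d → ℝ := fun t i => ∑ n, e t n * x n i with hS
  set E : ℝ → ℝ := fun t => ∑ n, e t n with hE
  have hEpos : ∀ t, 0 < E t := fun t =>
    sum_pos (fun n _ => Real.exp_pos _) ⟨⟨0, hN⟩, mem_univ _⟩
  have hLE : ∀ t, Lf t = E t / N := fun t => by rw [hLf]; simp only [hE, he]; ring
  have hupc : ∀ i, ContinuousOn (fun s => up s i) (Set.Ici 0) := fun i t ht =>
    (hflowp t ht i).continuousAt.continuousWithinAt
  have humc : ∀ i, ContinuousOn (fun s => um s i) (Set.Ici 0) := fun i t ht =>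
    (hflowm t ht i).continuousAt.continuousWithinAt
  have hwc : ∀ i, ContinuousOn (fun s => w s i) (Set.Ici 0) := fun i => by
    simp only [hw]
    exact ((hupc i).pow _).sub ((humc i).pow _)
  have hSc : ∀ i, ContinuousOn (fun s => S s i) (Set.Ici 0) := fun i => by
    simp only [hS, he]
    fun_prop
  have hpp : ∀ t, 0 ≤ t → ∀ i, 0 < up t i := fun t ht i => by
    refine pos_of_hasDerivAt_mul (u := fun s => up s i)
      (a := fun s => d' / N * up s i ^ k * S s i) ?_ (fun s hs => ?_) ?_ ht
    · exact (continuousOn_const.mul ((hupc i).pow k)).mul (hSc i)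
    · convert hflowp s hs i using 1
      ring
    · simpa [(hinit i).1] using hα
  have hmp : ∀ t, 0 ≤ t → ∀ i, 0 < um t i := fun t ht i => by
    refine pos_of_hasDerivAt_mul (u := fun s => um s i)
      (a := fun s => -(d' / N * um s i ^ k * S s i)) ?_ (fun s hs => ?_) ?_ ht
    · exact ((continuousOn_const.mul ((humc i).pow k)).mul (hSc i)).neg
    · convert hflowm s hs i using 1
      ring
    · simpa [(hinit i).2] using hα
  have hP : ∀ t, 0 ≤ t → ∀ i, HasDerivAt (fun s => (up s i ^ k)⁻¹)
      (-(k * (d' / N * S t i))) t := fun t ht i =>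
    hasDerivAt_inv_pow (u := fun s => up s i) (hpp t ht i)
      (by convert hflowp t ht i using 1; ring)
  have hQ : ∀ t, 0 ≤ t → ∀ i, HasDerivAt (fun s => (um s i ^ k)⁻¹)
      (-(k * -(d' / N * S t i))) t := fun t ht i =>
    hasDerivAt_inv_pow (u := fun s => um s i) (hmp t ht i)
      (by convert hflowm t ht i using 1; ring)
  have hPQ : ∀ t, 0 ≤ t → ∀ i, (up t i ^ k)⁻¹ + (um t i ^ k)⁻¹ = 2 * (α ^ k)⁻¹ := by
    intro t ht i
    have hg : ∀ s, 0 ≤ s → HasDerivAt (fun s => (up s i ^ k)⁻¹ + (um s i ^ k)⁻¹) 0 s :=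
      fun s hs => by
        refine ((hP s hs i).fun_add (hQ s hs i)).congr_deriv ?_
        ring
    have := constant_of_has_deriv_right_zero (a := 0) (b := t)
      (fun s hs => (hg s hs.1).continuousAt.continuousWithinAt)
      (fun s hs => (hg s hs.1).hasDerivWithinAt) t ⟨ht, le_rfl⟩
    rw [this, (hinit i).1, (hinit i).2]
    ring
  set G : ℝ → Fin d → ℝ := fun t i => up t i ^ (2 * (k + 1)) + um t i ^ (2 * (k + 1)) with hG
  have hGle : ∀ t, 0 ≤ t → ∀ i, 2 * α ^ (2 * (k + 1)) ≤ G t i := fun t ht i =>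
    two_mul_pow_le_of_inv_pow_add_inv_pow hk0 hα (hpp t ht i) (hmp t ht i) (hPQ t ht i) _
  have hw' : ∀ t, 0 ≤ t → ∀ i, HasDerivAt (fun s => w s i) (d' ^ 2 / N * G t i * S t i) t :=
    fun t ht i => by
      simp only [hw]
      refine (((hflowp t ht i).fun_pow (k + 2)).fun_sub ((hflowm t ht i).fun_pow (k + 2))).congr_deriv ?_
      simp only [hG, hS, he, hw, hD1, ← hd']
      ring
  have hE' : ∀ t, 0 ≤ t → HasDerivAt E (-(d' ^ 2 / N * ∑ i, G t i * S t i ^ 2)) t :=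
    fun t ht => by
      have h1 : ∀ n ∈ (univ : Finset (Fin N)), HasDerivAt (fun s => e s n)
          (e t n * -(∑ j, x n j * (d' ^ 2 / N * G t j * S t j))) t := fun n _ =>
        (HasDerivAt.fun_sum fun j _ => (hw' t ht j).const_mul (x n j)).fun_neg.exp
      refine (HasDerivAt.fun_sum h1).congr_deriv ?_
      have h2 : ∀ i, G t i * S t i ^ 2 = ∑ n, G t i * S t i * (e t n * x n i) := fun i => by
        rw [← mul_sum]; ring
      simp only [h2, mul_sum, mul_neg, sum_neg_distrib]
      rw [sum_comm]
      congr 1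
      refine sum_congr rfl fun n _ => sum_congr rfl fun i _ => ?_
      ring
  have hlog' : ∀ t, 0 ≤ t → HasDerivAt (fun s => -Real.log (Lf s))
      ((d' ^ 2 / N * ∑ i, G t i * S t i ^ 2) / E t) t := fun t ht => by
    simp only [hLE]
    have := hEpos t
    refine (((hE' t ht).div_const (N : ℝ)).log (by positivity)).fun_neg.congr_deriv ?_
    field_simp
  have hlog_le : ∀ t, 0 ≤ t → 2 * d' ^ 2 * α ^ (2 * (k + 1)) * γ₂ ^ 2 * (E t / N) ≤
      (d' ^ 2 / N * ∑ i, G t i * S t i ^ 2) / E t := fun t ht => by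
    have h1 : 2 * α ^ (2 * (k + 1)) * (γ₂ ^ 2 * E t ^ 2) ≤ ∑ i, G t i * S t i ^ 2 := by
      calc _ ≤ 2 * α ^ (2 * (k + 1)) * ∑ i, S t i ^ 2 := by
            gcongr
            exact margin_sq_mul_le hγ₂pos.le hv1 hvm (he0 t)
        _ = ∑ i, 2 * α ^ (2 * (k + 1)) * S t i ^ 2 := mul_sum _ _ _
        _ ≤ _ := sum_le_sum fun i _ => mul_le_mul_of_nonneg_right (hGle t ht i) (sq_nonneg _)
    rw [le_div_iff₀ (hEpos t)]
    calc _ = d' ^ 2 / N * (2 * α ^ (2 * (k + 1)) * (γ₂ ^ 2 * E t ^ 2)) := by ring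
      _ ≤ _ := by gcongr
  have hlog0 : -Real.log (Lf 0) = 0 := by
    have : Lf 0 = 1 := by
      rw [hLf]
      simp [hw, hinit, hNpos.ne']
    simp [this]
  have hxbar0 : 0 ≤ xbar := by
    obtain ⟨i, hi⟩ := hxbar.1
    rw [hi]
    positivity
  intro t ht hlt i z hz
  set K : ℝ := k * xbar / (2 * d' * γ₂ ^ 2 * α ^ (k + 2)) with hK
  have hK0 : 0 ≤ K := by positivity
  set b : ℝ → ℝ := fun s => 1 - α ^ k * (up s i ^ k)⁻¹ with hb
  have hb' : ∀ s, 0 ≤ s → HasDerivAt b (α ^ k * (k * (d' / N * S s i))) s := fun s hs => by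
    refine (((hP s hs i).const_mul (α ^ k)).const_sub 1).congr_deriv ?_
    ring
  have hb0 : b 0 = 0 := by
    simp [hb, (hinit i).1, hα.ne']
  have hb'_le : ∀ s, 0 ≤ s → |α ^ k * (k * (d' / N * S s i))| ≤
      K * ((d' ^ 2 / N * ∑ i, G s i * S s i ^ 2) / E s) := fun s hs => by
    have h1 : |S s i| ≤ xbar * E s :=
      (abs_sum_mul_le (he0 s)).trans
        (mul_le_mul_of_nonneg_right (hxbar.2 ⟨i, rfl⟩) (hEpos s).le)
    calc |α ^ k * (k * (d' / N * S s i))| = α ^ k * (k * (d' / N)) * |S s i| := by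
          rw [← mul_assoc, ← mul_assoc, abs_mul, abs_of_nonneg (by positivity)]
          ring
      _ ≤ α ^ k * (k * (d' / N)) * (xbar * E s) := by gcongr
      _ = K * (2 * d' ^ 2 * α ^ (2 * (k + 1)) * γ₂ ^ 2 * (E s / N)) := by
          rw [hK]
          field_simp
          ring
      _ ≤ _ := mul_le_mul_of_nonneg_left (hlog_le s hs) hK0
  have hbz : |b t| ≤ z := by
    have m1 := monotoneOn_Ici_of_hasDerivAt_nonneg
      (fun s hs => ((hlog' s hs).const_mul K).sub (hb' s hs))
      (fun s hs => sub_nonneg.mpr ((le_abs_self _).trans (hb'_le s hs)))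
      Set.self_mem_Ici (Set.mem_Ici.mpr ht) ht
    have m2 := monotoneOn_Ici_of_hasDerivAt_nonneg
      (fun s hs => ((hlog' s hs).const_mul K).add (hb' s hs))
      (fun s hs => by linarith [(neg_abs_le _).trans' (neg_le_neg (hb'_le s hs))])
      Set.self_mem_Ici (Set.mem_Ici.mpr ht) ht
    simp only [Pi.sub_apply, Pi.add_apply, hlog0, hb0] at m1 m2
    rw [hz, abs_le]
    constructor <;> linarith
  have hz1 : z < 1 := by
    rw [hz, hK, div_mul_eq_mul_div, div_lt_one (by positivity)]
    exact hlt
  have e1 : up t i ^ (k + 2) = α ^ (k + 2) * (1 - b t) ^ (-d' / (k : ℝ)) :=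
    pow_eq_mul_rpow_of_inv_pow hk0 hα (hpp t ht i) (by simp [hb])
  have e2 : um t i ^ (k + 2) = α ^ (k + 2) * (1 + b t) ^ (-d' / (k : ℝ)) := by
    refine pow_eq_mul_rpow_of_inv_pow hk0 hα (hmp t ht i) ?_
    have := hPQ t ht i
    have h3 : (um t i ^ k)⁻¹ = 2 * (α ^ k)⁻¹ - (up t i ^ k)⁻¹ := by linarith
    rw [h3, hb]
    field_simp
    ring
  rw [hw, e1, e2, ← mul_sub, abs_mul, abs_of_pos (by positivity : 0 < α ^ (k + 2))]
  refine mul_le_mul_of_nonneg_left (abs_rpow_sub_rpow_le ?_ hbz hz1) (by positivity)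
  exact div_nonpos_of_nonpos_of_nonneg (by linarith) hkpos.le
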